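/- arXiv:0712.0933 — 7 statements merged into one kernel-verified Lean document; each statement's English description precedes it below -/
import Mathlib

section
/- Let c ∈ ℚ and let (a_n), (b_n), (d_n), (f_n) be sequences of rationals with a_n ≠ 0 for all n, satisfying for all n ≥ 0: a_{n+1} = -(−a_n^3 + a_n^2 d_n − a_n c b_n + b_n^2)/a_n^2, b_{n+1} = -(a_n^4 f_n + c a_n^3 d_n − c^2 a_n^2 b_n + 2 c a_n b_n^2 − b_n a_n^2 d_n − b_n^3)/a_n^3, d_{n+1} = -(−2 a_n c b_n + 2 b_n^2 + a_n^2 d_n)/a_n^2, and f_{n+1} = −b_n/a_n. Then for all n ≥ 0: a_{n+2}·a_{n+1} + a_{n+1}·a_n = 2·a_0·a_1 + a_0·(f_0 + f_1 + c)·(2·f_1 + c) − (a_0·(f_0 + f_1 + c))^2 / a_{n+1}. -/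
/-- Theorem 2 of the paper: under the recursions of the iterated quadratic
transformation (with `cₙ = c`, `eₙ = −1`),
`a_{n+2}·a_{n+1} + a_{n+1}·aₙ = 2·a₀·a₁ + a₀(f₀+f₁+c)(2f₁+c) − (a₀(f₀+f₁+c))²/a_{n+1}`. -/
theorem recursion_solution (c : ℚ) (a b d f : ℕ → ℚ)
    (ha : ∀ n, a n ≠ 0)
    (hrec_a : ∀ n, a (n + 1) = -((-(a n ^ 3) + a n ^ 2 * d n - a n * c * b n + b n ^ 2) / a n ^ 2))
    (hrec_b : ∀ n, b (n + 1) = -((a n ^ 4 * f n + c * a n ^ 3 * d n - c ^ 2 * a n ^ 2 * b n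
        + 2 * c * a n * b n ^ 2 - b n * a n ^ 2 * d n - b n ^ 3) / a n ^ 3))
    (hrec_d : ∀ n, d (n + 1) = -((-(2 * a n * c * b n) + 2 * b n ^ 2 + a n ^ 2 * d n) / a n ^ 2))
    (hrec_f : ∀ n, f (n + 1) = -(b n / a n)) :
    ∀ n : ℕ, a (n + 2) * a (n + 1) + a (n + 1) * a n
      = 2 * a 0 * a 1 + a 0 * (f 0 + f 1 + c) * (2 * f 1 + c)
        - (a 0 * (f 0 + f 1 + c)) ^ 2 / a (n + 1) := by
  have hb : ∀ n, b n = -(a n * f (n + 1)) := by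
    intro n
    have h := ha n
    rw [hrec_f]
    field_simp
  have hA : ∀ n, a (n + 1) = a n - d n - c * f (n + 1) - f (n + 1) ^ 2 := by
    intro n
    have h := ha n
    rw [hrec_a, hb]
    field_simp
    ring
  have hD : ∀ n, d (n + 1) = -(2 * c * f (n + 1) + 2 * f (n + 1) ^ 2 + d n) := by
    intro n
    have h := ha n
    rw [hrec_d, hb]
    field_simp
  have hB : ∀ n, b (n + 1) = -(a n * f n
      + (c + f (n + 1)) * (d n + c * f (n + 1) + f (n + 1) ^ 2)) := by
    intro n
    have h := ha n
    rw [hrec_b, hb]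
    field_simp
    ring
  -- the first invariant `aₙ (fₙ + fₙ₊₁ + c)`
  have hstep : ∀ n, a (n + 1) * (f (n + 1) + f (n + 2) + c) = a n * (f n + f (n + 1) + c) := by
    intro n
    have h1 := hB n
    have h2 : b (n + 1) = -(a (n + 1) * f (n + 2)) := hb (n + 1)
    linear_combination h2 - h1 + (c + f (n + 1)) * hA n
  have hK : ∀ n, a n * (f n + f (n + 1) + c) = a 0 * (f 0 + f 1 + c) := by
    intro n
    induction n with
    | zero => simp
    | succ k ih => exact (hstep k).trans ih
  generalize a 0 * (f 0 + f 1 + c) = K at hK ⊢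
  have hAA : ∀ n, a (n + 2) * a (n + 1) = a (n + 1) * a n + (f (n + 1) - f (n + 2)) * K := by
    intro n
    have h1 : a (n + 2) = a (n + 1) - d (n + 1) - c * f (n + 2) - f (n + 2) ^ 2 := hA (n + 1)
    have h2 : a (n + 1) * (f (n + 1) + f (n + 2) + c) = K := hK (n + 1)
    linear_combination a (n + 1) * (h1 - hD n + hA n) + (f (n + 1) - f (n + 2)) * h2
  -- the second invariant
  have hJ : ∀ n, 2 * a n * a (n + 1) + K * (2 * f (n + 1) + c)
      = 2 * a 0 * a 1 + K * (2 * f 1 + c) := by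
    intro n
    induction n with
    | zero => simp
    | succ k ih =>
      rw [← ih]
      have h := hAA k
      linear_combination 2 * h
  intro n
  rw [← hJ n]
  have h2 : a (n + 1) * (f (n + 1) + f (n + 2) + c) = K := hK (n + 1)
  have h3 : K ^ 2 / a (n + 1) = K * (f (n + 1) + f (n + 2) + c) := by
    rw [div_eq_iff (ha (n + 1))]
    linear_combination -K * h2
  rw [h3]
  linear_combination hAA n
end

section
/- Let c ∈ ℚ and let (a_n), (b_n), (d_n), (f_n) be sequences of rationals with a_n ≠ 0 for all n, satisfying for all n ≥ 0: a_{n+1} = -(−a_n^3 + a_n^2 d_n − a_n c b_n + b_n^2)/a_n^2, b_{n+1} = -(a_n^4 f_n + c a_n^3 d_n − c^2 a_n^2 b_n + 2 c a_n b_n^2 − b_n a_n^2 d_n − b_n^3)/a_n^3, d_{n+1} = -(−2 a_n c b_n + 2 b_n^2 + a_n^2 d_n)/a_n^2, and f_{n+1} = −b_n/a_n. Then for all n ≥ 0: a_{n+1}·(f_{n+2} + f_{n+1} + c) = a_0·(f_1 + f_0 + c). -/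
/-- Equation (8) of the paper: a_{n+1}(f_{n+2} + f_{n+1} + c) = a₀(f₁ + f₀ + c). -/
theorem ffc_invariant (c : ℚ) (a b d f : ℕ → ℚ)
    (ha : ∀ n, a n ≠ 0)
    (hrec_a : ∀ n, a (n + 1) = -((-(a n ^ 3) + a n ^ 2 * d n - a n * c * b n + b n ^ 2) / a n ^ 2))
    (hrec_b : ∀ n, b (n + 1) = -((a n ^ 4 * f n + c * a n ^ 3 * d n - c ^ 2 * a n ^ 2 * b n
        + 2 * c * a n * b n ^ 2 - b n * a n ^ 2 * d n - b n ^ 3) / a n ^ 3))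
    (hrec_d : ∀ n, d (n + 1) = -((-(2 * a n * c * b n) + 2 * b n ^ 2 + a n ^ 2 * d n) / a n ^ 2))
    (hrec_f : ∀ n, f (n + 1) = -(b n / a n)) :
    ∀ n : ℕ, a (n + 1) * (f (n + 2) + f (n + 1) + c) = a 0 * (f 1 + f 0 + c) := by
  have key : ∀ n, a (n + 1) * (f (n + 2) + f (n + 1) + c) = a n * (f (n + 1) + f n + c) := by
    intro n
    have h0 := ha n
    have h1 := ha (n + 1)
    have e : a (n + 1) * f (n + 2) = -b (n + 1) := by
      rw [hrec_f (n + 1)]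
      field_simp
    rw [mul_add, mul_add, e, hrec_b n, hrec_f n, hrec_a n]
    field_simp
    ring
  intro n
  induction n with
  | zero => exact key 0
  | succ k ih => exact (key (k + 1)).trans ih
end

section
/- Let c ∈ ℚ and let (a_n), (b_n), (d_n), (f_n) be sequences of rationals with a_n ≠ 0 for all n, satisfying for all n ≥ 0: a_{n+1} = -(−a_n^3 + a_n^2 d_n − a_n c b_n + b_n^2)/a_n^2, b_{n+1} = -(a_n^4 f_n + c a_n^3 d_n − c^2 a_n^2 b_n + 2 c a_n b_n^2 − b_n a_n^2 d_n − b_n^3)/a_n^3, d_{n+1} = -(−2 a_n c b_n + 2 b_n^2 + a_n^2 d_n)/a_n^2, and f_{n+1} = −b_n/a_n. Then for all n ≥ 0: a_0·a_1 − a_{n+1}·a_{n+2} = a_0·(f_1 + f_0 + c)·(f_{n+2} − f_1). -/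
/-- Equation (9) of the paper: a₀a₁ − a_{n+1}a_{n+2} = a₀(f₁ + f₀ + c)(f_{n+2} − f₁). -/
theorem fff_identity (c : ℚ) (a b d f : ℕ → ℚ)
    (ha : ∀ n, a n ≠ 0)
    (hrec_a : ∀ n, a (n + 1) = -((-(a n ^ 3) + a n ^ 2 * d n - a n * c * b n + b n ^ 2) / a n ^ 2))
    (hrec_b : ∀ n, b (n + 1) = -((a n ^ 4 * f n + c * a n ^ 3 * d n - c ^ 2 * a n ^ 2 * b n
        + 2 * c * a n * b n ^ 2 - b n * a n ^ 2 * d n - b n ^ 3) / a n ^ 3))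
    (hrec_d : ∀ n, d (n + 1) = -((-(2 * a n * c * b n) + 2 * b n ^ 2 + a n ^ 2 * d n) / a n ^ 2))
    (hrec_f : ∀ n, f (n + 1) = -(b n / a n)) :
    ∀ n : ℕ, a 0 * a 1 - a (n + 1) * a (n + 2) = a 0 * (f 1 + f 0 + c) * (f (n + 2) - f 1) := by
  have hb : ∀ n, b n = -(a n * f (n + 1)) := by
    intro n
    have h := ha n
    rw [hrec_f n]
    field_simp
  have hA : ∀ n, a (n + 1) = a n - d n - c * f (n + 1) - f (n + 1) ^ 2 := by
    intro n
    have h := ha n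
    rw [hrec_a n, hb n]
    field_simp
    ring
  have hD : ∀ n, d (n + 1) = -(2 * c * f (n + 1) + 2 * f (n + 1) ^ 2 + d n) := by
    intro n
    have h := ha n
    rw [hrec_d n, hb n]
    field_simp
  have hB : ∀ n, b (n + 1) = -(a n * f n + (c + f (n + 1)) * d n
      + f (n + 1) * (c + f (n + 1)) ^ 2) := by
    intro n
    have h := ha n
    rw [hrec_b n, hb n]
    field_simp
    ring
  -- the conserved quantity
  have hK : ∀ n, a n * (f (n + 1) + f n + c) = a 0 * (f 1 + f 0 + c) := by
    intro n
    induction n with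
    | zero => rfl
    | succ n ih =>
      rw [← ih]
      have h1 := hB n
      rw [hb (n + 1)] at h1
      linear_combination -h1 + (f (n + 1) + c) * hA n
  have hS : ∀ n, a n * a (n + 1) - a (n + 1) * a (n + 2)
      = a 0 * (f 1 + f 0 + c) * (f (n + 2) - f (n + 1)) := by
    intro n
    have h1 := hK (n + 1)
    have h2 := hA n
    have h3 := hA (n + 1)
    have h4 := hD n
    rw [← h1]
    linear_combination -a (n + 1) * (h2 + h3 - h4)
  intro n
  induction n with
  | zero => exact hS 0
  | succ n ih => linear_combination ih + hS (n + 1)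
end

section
/- Let (a_n), (b_n), (d_n), (f_n) be sequences of rationals with a_n ≠ 0 for all n, with initial values a_0 = 1, b_0 = −1, d_0 = 0, f_0 = 0, and constant c = −2, satisfying for all n ≥ 0: a_{n+1} = -(−a_n^3 + a_n^2 d_n − a_n c b_n + b_n^2)/a_n^2, b_{n+1} = -(a_n^4 f_n + c a_n^3 d_n − c^2 a_n^2 b_n + 2 c a_n b_n^2 − b_n a_n^2 d_n − b_n^3)/a_n^3, d_{n+1} = -(−2 a_n c b_n + 2 b_n^2 + a_n^2 d_n)/a_n^2, and f_{n+1} = −b_n/a_n. Then a_1 = 2, f_1 = 1, and for all n ≥ 0: a_{n+2} = 4/a_{n+1} − a_n − 1/a_{n+1}^2. -/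
/-- With initial values `a₀ = 1, b₀ = −1, d₀ = 0, f₀ = 0` and constant `c = −2`,
the recursion system yields `a₁ = 2`, `f₁ = 1`, and
`a_{n+2} = 4/a_{n+1} − aₙ − 1/a_{n+1}²` (equation (10) of the paper). -/
theorem somos_case_recursion (a b d f : ℕ → ℚ)
    (ha : ∀ n, a n ≠ 0)
    (ha0 : a 0 = 1) (hb0 : b 0 = -1) (hd0 : d 0 = 0) (hf0 : f 0 = 0)
    (hrec_a : ∀ n, a (n + 1)
      = -((-(a n ^ 3) + a n ^ 2 * d n - a n * (-2) * b n + b n ^ 2) / a n ^ 2))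
    (hrec_b : ∀ n, b (n + 1) = -((a n ^ 4 * f n + (-2) * a n ^ 3 * d n
        - (-2) ^ 2 * a n ^ 2 * b n + 2 * (-2) * a n * b n ^ 2
        - b n * a n ^ 2 * d n - b n ^ 3) / a n ^ 3))
    (hrec_d : ∀ n, d (n + 1)
      = -((-(2 * a n * (-2) * b n) + 2 * b n ^ 2 + a n ^ 2 * d n) / a n ^ 2))
    (hrec_f : ∀ n, f (n + 1) = -(b n / a n)) :
    a 1 = 2 ∧ f 1 = 1 ∧
      ∀ n : ℕ, a (n + 2) = 4 / a (n + 1) - a n - 1 / a (n + 1) ^ 2 := by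
  obtain ⟨u, hu⟩ : ∃ u : ℕ → ℚ, ∀ n, b n = u n * a n :=
    ⟨fun n => b n / a n, fun n => (div_mul_cancel₀ _ (ha n)).symm⟩
  have hA : ∀ n, a (n + 1) = a n - d n - 2 * u n - u n ^ 2 := by
    intro n
    have h := ha n
    rw [hrec_a, hu]
    field_simp
    ring
  have hD : ∀ n, d (n + 1) = -(4 * u n + 2 * u n ^ 2 + d n) := by
    intro n
    have h := ha n
    rw [hrec_d, hu]
    field_simp
    ring
  have hF : ∀ n, f (n + 1) = -u n := by
    intro n
    have h := ha n
    rw [hrec_f, hu]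
    field_simp
  have hB : ∀ n, u (n + 1) * a (n + 1) = (2 + u n) * (a n - a (n + 1)) - a n * f n := by
    intro n
    have h := ha n
    rw [← hu, hrec_b, hA, hu]
    field_simp
    ring
  have hu0 : u 0 = -1 := by
    have := hu 0
    rw [ha0, hb0] at this
    linarith
  have hA2 : ∀ n, a (n + 2) = a n + (u n + 1) ^ 2 - (u (n + 1) + 1) ^ 2 := by
    intro n
    have h1 := hA (n + 1)
    have h2 := hA n
    have h3 := hD n
    linear_combination h1 + h2 - h3
  -- first invariant
  have I1 : ∀ n, a n * (u n + 2 - f n) = 1 := by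
    intro n
    induction n with
    | zero => rw [ha0, hu0, hf0]; norm_num
    | succ n ih =>
      rw [hF]
      linear_combination ih + hB n
  have J1 : ∀ n, a (n + 1) * (u (n + 1) + 2 + u n) = 1 := by
    intro n
    have := I1 (n + 1)
    rw [hF] at this
    linear_combination this
  have ha1 : a 1 = 2 := by
    have := hA 0
    rw [ha0, hd0, hu0] at this
    norm_num at this
    exact this
  -- second invariant
  have I2 : ∀ n, a n * a (n + 1) = 1 - u n := by
    intro n
    induction n with
    | zero => rw [ha0, hu0, ha1]; norm_num
    | succ n ih =>
      have h := hA2 n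
      have h1 := J1 n
      linear_combination a (n + 1) * h + ih + (u n - u (n + 1)) * h1
  refine ⟨ha1, ?_, ?_⟩
  · rw [hF 0, hu0]; norm_num
  · intro n
    have h := ha (n + 1)
    have h1 := J1 n
    have h2 := I2 n
    have h3 := I2 (n + 1)
    field_simp
    linear_combination a (n + 1) * h3 + a (n + 1) * h2 - h1
end

section
/- Let (a_n) be a sequence of nonzero rationals with a_0 = 1, a_1 = 2, satisfying a_{n+2} = 4/a_{n+1} − a_n − 1/a_{n+1}^2 for all n ≥ 0. Then for all n ≥ 0: 4·a_n·a_{n+1} − a_n − a_n^2·a_{n+1}^2 − 1 − a_{n+1} = 0. -/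
/-- The claim `T(n) = 0` in the proof of the Somos-4 conjecture:
`4·aₙ·a_{n+1} − aₙ − aₙ²·a_{n+1}² − 1 − a_{n+1} = 0` for the sequence with
`a₀ = 1, a₁ = 2` and `a_{n+2} = 4/a_{n+1} − aₙ − 1/a_{n+1}²`. -/
theorem T_vanishes (a : ℕ → ℚ) (ha : ∀ n, a n ≠ 0)
    (ha0 : a 0 = 1) (ha1 : a 1 = 2)
    (hrec : ∀ n, a (n + 2) = 4 / a (n + 1) - a n - 1 / a (n + 1) ^ 2) :
    ∀ n : ℕ, 4 * a n * a (n + 1) - a n - a n ^ 2 * a (n + 1) ^ 2 - 1 - a (n + 1) = 0 := by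
  intro n
  induction n with
  | zero => norm_num [ha0, ha1]
  | succ n ih =>
    have hy := ha (n + 1)
    have h : a (n + 1) ^ 2 * (a (n + 2) + a n) = 4 * a (n + 1) - 1 := by
      rw [hrec n]
      field_simp
      ring
    show 4 * a (n + 1) * a (n + 2) - a (n + 1) - a (n + 1) ^ 2 * a (n + 2) ^ 2 - 1
      - a (n + 2) = 0
    linear_combination ih - (a (n + 2) - a n) * h
end

section
/- Let (a_n) be a sequence of nonzero rationals with a_0 = 1, a_1 = 2, satisfying a_{n+2} = 4/a_{n+1} − a_n − 1/a_{n+1}^2 for all n ≥ 0. Then for all n ≥ 0: a_{n+2}·a_{n+1}^2·a_n = a_{n+1} + 1 (equivalently, a_{n+2}·a_{n+1}·a_n = 1 + 1/a_{n+1}). -/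
/-- The recursion (6) of the paper: for the sequence with `a₀ = 1, a₁ = 2` and
`a_{n+2} = 4/a_{n+1} − aₙ − 1/a_{n+1}²`, one has
`a_{n+2}·a_{n+1}²·aₙ = a_{n+1} + 1`, i.e. `a_{n+2}·a_{n+1}·aₙ = 1 + 1/a_{n+1}`. -/
theorem a_recursion (a : ℕ → ℚ) (ha : ∀ n, a n ≠ 0)
    (ha0 : a 0 = 1) (ha1 : a 1 = 2)
    (hrec : ∀ n, a (n + 2) = 4 / a (n + 1) - a n - 1 / a (n + 1) ^ 2) :
    ∀ n : ℕ, a (n + 2) * a (n + 1) ^ 2 * a n = a (n + 1) + 1 := by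
  have key : ∀ n, a (n + 2) * a (n + 1) ^ 2 = 4 * a (n + 1) - a n * a (n + 1) ^ 2 - 1 := by
    intro n
    have h := ha (n + 1)
    rw [hrec n]
    field_simp
  intro n
  induction n with
  | zero =>
    have h := key 0
    simp only [zero_add] at h ⊢
    rw [ha0, ha1] at *
    linarith
  | succ k ih =>
    have h1 := key k
    have h2 := key (k + 1)
    simp only [add_assoc, Nat.reduceAdd] at *
    linear_combination a (k + 1) * h2 - a (k + 2) * h1 + ih
end

section
/- Let (a_n) be a sequence of nonzero rationals and define s_n = Π_{i=0}^{n-1} a_i^{n-i} for n ≥ 0 (so s_0 = 1). Then for every n ≥ 4, the identity s_n·s_{n-4} = s_{n-1}·s_{n-3} + s_{n-2}^2 holds if and only if a_{n-1}·a_{n-2}^2·a_{n-3} = a_{n-2} + 1 (equivalently a_{n-1}·a_{n-2}·a_{n-3} = 1 + 1/a_{n-2}). -/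
theorem somos_step_aux (a : ℕ → ℚ)
    (s : ℕ → ℚ) (hs : ∀ n, s n = ∏ i ∈ Finset.range n, a i ^ (n - i)) (n : ℕ) :
    s (n + 1) = s n * ∏ i ∈ Finset.range (n + 1), a i := by
  rw [hs, hs, Finset.prod_range_succ, Finset.prod_range_succ, ← mul_assoc,
    ← Finset.prod_mul_distrib]
  congr 1
  · refine Finset.prod_congr rfl fun i hi => ?_
    have hi' := Finset.mem_range.mp hi
    rw [← pow_succ, Nat.sub_add_comm hi'.le]
  · simp

/-- For `sₙ = ∏_{i=0}^{n-1} aᵢ^{n-i}` built from a sequence of nonzero rationals,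
the Somos-4 recursion `sₙ·s_{n-4} = s_{n-1}·s_{n-3} + s_{n-2}²` at index `n ≥ 4`
is equivalent to `a_{n-1}·a_{n-2}²·a_{n-3} = a_{n-2} + 1`. -/
theorem somos_recursion_iff (a : ℕ → ℚ) (ha : ∀ n, a n ≠ 0)
    (s : ℕ → ℚ) (hs : ∀ n, s n = ∏ i ∈ Finset.range n, a i ^ (n - i)) :
    ∀ n : ℕ, 4 ≤ n →
      (s n * s (n - 4) = s (n - 1) * s (n - 3) + s (n - 2) ^ 2 ↔
        a (n - 1) * a (n - 2) ^ 2 * a (n - 3) = a (n - 2) + 1) := by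
  intro n hn
  obtain ⟨m, rfl⟩ := Nat.exists_eq_add_of_le' hn
  have e1 : m + 4 - 1 = m + 3 := rfl
  have e2 : m + 4 - 2 = m + 2 := rfl
  have e3 : m + 4 - 3 = m + 1 := rfl
  have e4 : m + 4 - 4 = m := rfl
  rw [e1, e2, e3, e4]
  have h1 := somos_step_aux a s hs m
  have h2 := somos_step_aux a s hs (m + 1)
  have h3 := somos_step_aux a s hs (m + 2)
  have h4 := somos_step_aux a s hs (m + 3)
  rw [Finset.prod_range_succ _ (m + 3)] at h4
  rw [Finset.prod_range_succ _ (m + 2)] at h3 h4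
  rw [Finset.prod_range_succ _ (m + 1)] at h2 h3 h4
  have hQ : ∏ i ∈ Finset.range (m + 1), a i ≠ 0 := Finset.prod_ne_zero_iff.mpr fun i _ => ha i
  have hS : s m ≠ 0 := by
    rw [hs]
    exact Finset.prod_ne_zero_iff.mpr fun i _ => pow_ne_zero _ (ha i)
  generalize ∏ i ∈ Finset.range (m + 1), a i = Q at *
  have hb := ha (m + 1)
  have hK : s m ^ 2 * Q ^ 4 * a (m + 1) ^ 2 ≠ 0 := by positivity
  rw [h4, h3, h2, h1]
  constructor
  · intro h
    apply mul_left_cancel₀ hK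
    linear_combination h
  · intro h
    linear_combination (s m ^ 2 * Q ^ 4 * a (m + 1) ^ 2) * h
end
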